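/- For every ε > 0 and all constants C, D > 0 there exist a constant c > 0 and a threshold n₀ such that for all n ≥ n₀: every deterministic circuit with n inputs of size at most C·n and depth at most D·log₂ n can be converted to a deterministic circuit computing the same Boolean function of size at most c·n^{1+ε} and width at most c·n / log₂ log₂ n. -/

import Mathlib

/-!
Common definitions: Boolean circuits (with AND/OR/NOT gates of fan-in ≤ 2 and
dummy COPY gates used only for layering), nondeterministic circuits with guess
inputs, width via layerings, nondeterministic branching programs, and
U₂-circuits with their deterministic/nondeterministic circuit complexities.
-/

/-- A node of a circuit with `n` actual inputs and `m` guess inputs.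
Gate nodes refer to their predecessors by (strictly smaller) indices. -/
inductive CNode (n m : ℕ) : Type where
  | actual : Fin n → CNode n m
  | guess  : Fin m → CNode n m
  | const  : Bool → CNode n m
  | gand   : ℕ → ℕ → CNode n m
  | gor    : ℕ → ℕ → CNode n m
  | gnot   : ℕ → CNode n m
  | gcopy  : ℕ → CNode n m
deriving DecidableEq

namespace CNode

/-- The predecessor indices of a node. -/
def preds {n m : ℕ} : CNode n m → List ℕ
  | gand j k => [j, k]
  | gor j k  => [j, k]
  | gnot j   => [j]
  | gcopy j  => [j]
  | _        => []

/-- Real gates (AND, OR, NOT); these are the gates counted in the size.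
COPY gates are dummy gates inserted only to make the circuit layered. -/
def isGate {n m : ℕ} : CNode n m → Bool
  | gand _ _ => true
  | gor _ _  => true
  | gnot _   => true
  | _        => false

/-- Nodes occupying space in a layer (real gates and COPY gates);
these are counted in the width of a layer. -/
def isWide {n m : ℕ} : CNode n m → Bool
  | gand _ _ => true
  | gor _ _  => true
  | gnot _   => true
  | gcopy _  => true
  | _        => false

end CNode

/-- A (nondeterministic) Boolean circuit with `n` actual inputs and `m` guess
inputs: a DAG whose in-degree-0 nodes are labeled by actual inputs, guess
inputs or constants, whose gates are AND/OR/NOT gates (plus dummy COPY gates),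
with a designated output node.  Each guess input labels at most one node. -/
structure Circuit (n m : ℕ) : Type where
  N : ℕ
  node : Fin N → CNode n m
  output : Fin N
  wf : ∀ i : Fin N, ∀ j ∈ (node i).preds, j < (i : ℕ)
  guessOnce : ∀ g : Fin m,
    (Finset.univ.filter (fun i : Fin N => node i = CNode.guess g)).card ≤ 1

namespace Circuit

variable {n m : ℕ}

def nodeAt (c : Circuit n m) (i : ℕ) : CNode n m :=
  if h : i < c.N then c.node ⟨i, h⟩ else CNode.const false

/-- The Boolean value computed at node `i` on actual inputs `x` and
guess inputs `y`. -/
def evalAux (c : Circuit n m) (x : Fin n → Bool) (y : Fin m → Bool) : ℕ → Bool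
  | i =>
    match c.nodeAt i with
    | CNode.actual a => x a
    | CNode.guess g => y g
    | CNode.const b => b
    | CNode.gand j k =>
        (if _h : j < i then c.evalAux x y j else false) &&
        (if _h : k < i then c.evalAux x y k else false)
    | CNode.gor j k =>
        (if _h : j < i then c.evalAux x y j else false) ||
        (if _h : k < i then c.evalAux x y k else false)
    | CNode.gnot j => !(if _h : j < i then c.evalAux x y j else false)
    | CNode.gcopy j => (if _h : j < i then c.evalAux x y j else false)
termination_by i => i

/-- The output value of the circuit. -/
def eval (c : Circuit n m) (x : Fin n → Bool) (y : Fin m → Bool) : Bool :=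
  c.evalAux x y c.output

/-- A nondeterministic circuit computes `f` if for every actual input `x`,
`f x = 1` iff some assignment of the guess inputs makes the circuit output 1.
(For `m = 0` this is the usual notion for deterministic circuits.) -/
def Computes (c : Circuit n m) (f : (Fin n → Bool) → Bool) : Prop :=
  ∀ x : Fin n → Bool, f x = true ↔ ∃ y : Fin m → Bool, c.eval x y = true

/-- The size of a circuit: the number of (non-COPY) gates. -/
def size (c : Circuit n m) : ℕ :=
  (Finset.univ.filter (fun i : Fin c.N => (c.node i).isGate = true)).card

/-- `ℓ` is a layering of the circuit: every wire goes between adjacent layers. -/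
def IsLayering (c : Circuit n m) (ℓ : Fin c.N → ℕ) : Prop :=
  ∀ i : Fin c.N, ∀ j ∈ (c.node i).preds, ∀ hj : j < c.N, ℓ ⟨j, hj⟩ + 1 = ℓ i

/-- The circuit has width at most `w`: there is a layering in which every layer
contains at most `w` gates (real gates and COPY gates). -/
def HasWidth (c : Circuit n m) (w : ℕ) : Prop :=
  ∃ ℓ : Fin c.N → ℕ, c.IsLayering ℓ ∧
    ∀ t : ℕ,
      (Finset.univ.filter
        (fun i : Fin c.N => ℓ i = t ∧ (c.node i).isWide = true)).card ≤ w

/-- The circuit is read-`k`-times: every actual input labels at most `k` nodes. -/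
def ReadK (c : Circuit n m) (k : ℕ) : Prop :=
  ∀ a : Fin n,
    (Finset.univ.filter (fun i : Fin c.N => c.node i = CNode.actual a)).card ≤ k

/-- The maximal number of (non-COPY) gates on a path ending at node `i`. -/
def depthAux (c : Circuit n m) : ℕ → ℕ
  | i =>
    match c.nodeAt i with
    | CNode.actual _ => 0
    | CNode.guess _ => 0
    | CNode.const _ => 0
    | CNode.gand j k =>
        max (if _h : j < i then c.depthAux j else 0)
            (if _h : k < i then c.depthAux k else 0) + 1
    | CNode.gor j k =>
        max (if _h : j < i then c.depthAux j else 0)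
            (if _h : k < i then c.depthAux k else 0) + 1
    | CNode.gnot j => (if _h : j < i then c.depthAux j else 0) + 1
    | CNode.gcopy j => (if _h : j < i then c.depthAux j else 0)
termination_by i => i

/-- The depth of a circuit: the maximal number of gates on a directed path
from an input to the output. -/
def depth (c : Circuit n m) : ℕ := c.depthAux c.output

end Circuit

/-- A nondeterministic branching program on `n` Boolean variables: a DAG whose
inner nodes are labeled by variables with outgoing edges labeled 0 or 1 (edges
go to strictly larger indices), whose sinks are labeled 0 or 1, with a
designated start node. -/
structure NBP (n : ℕ) : Type where
  N : ℕ
  label : Fin N → Fin n ⊕ Bool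
  edges : Fin N → Bool → Finset (Fin N)
  start : Fin N
  wf : ∀ i : Fin N, ∀ b : Bool, ∀ j ∈ edges i b,
        (i : ℕ) < (j : ℕ) ∧ (label i).isLeft

namespace NBP

variable {n : ℕ}

/-- The size of a branching program: the number of its nodes. -/
def size (B : NBP n) : ℕ := B.N

/-- On input `x`, some path from node `i` consistent with `x` reaches a 1-sink. -/
def AccFrom (B : NBP n) (x : Fin n → Bool) : Fin B.N → Prop
  | i =>
    match B.label i with
    | Sum.inr b => b = true
    | Sum.inl v => ∃ j ∈ B.edges i (x v), ∃ _h : (i : ℕ) < (j : ℕ), B.AccFrom x j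
termination_by i => B.N - (i : ℕ)
decreasing_by
  have := j.isLt
  omega

/-- A nondeterministic branching program computes `f` if for every `x`,
`f x = 1` iff at least one path consistent with `x` leads to a 1-sink. -/
def Computes (B : NBP n) (f : (Fin n → Bool) → Bool) : Prop :=
  ∀ x : Fin n → Bool, f x = true ↔ B.AccFrom x B.start

/-- A (syntactic) path in the underlying graph of the branching program. -/
def IsPath (B : NBP n) : List (Fin B.N) → Prop
  | [] => True
  | [_] => True
  | i :: j :: p => (∃ b : Bool, j ∈ B.edges i b) ∧ B.IsPath (j :: p)

/-- The branching program is syntactic read-`k`-times: every variable appears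
at most `k` times on each path. -/
def SyntacticReadK (B : NBP n) (k : ℕ) : Prop :=
  ∀ p : List (Fin B.N), B.IsPath p → ∀ v : Fin n,
    (p.countP fun i => decide (B.label i = Sum.inl v)) ≤ k

end NBP

/-- A node of a `U₂`-circuit.  A gate `gate a b c j k` computes
`((vⱼ ⊕ a) ∧ (v_k ⊕ b)) ⊕ c` from the values `vⱼ, v_k` of its two
predecessors; these are exactly the Boolean functions in `U₂`
(all two-variable Boolean functions except XOR and its complement). -/
inductive U2Node (n m : ℕ) : Type where
  | actual : Fin n → U2Node n m
  | guess  : Fin m → U2Node n m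
  | const  : Bool → U2Node n m
  | gate   : Bool → Bool → Bool → ℕ → ℕ → U2Node n m
deriving DecidableEq

namespace U2Node

def isGate {n m : ℕ} : U2Node n m → Bool
  | gate _ _ _ _ _ => true
  | _ => false

end U2Node

/-- A (nondeterministic) `U₂`-circuit with `n` actual inputs and `m` guess
inputs: every gate has fan-in 2 and is labeled by a function in `U₂`. -/
structure U2Circuit (n m : ℕ) : Type where
  N : ℕ
  node : Fin N → U2Node n m
  output : Fin N
  wf : ∀ i : Fin N, ∀ a b c j k,
        node i = U2Node.gate a b c j k → j < (i : ℕ) ∧ k < (i : ℕ)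

namespace U2Circuit

variable {n m : ℕ}

def nodeAt (c : U2Circuit n m) (i : ℕ) : U2Node n m :=
  if h : i < c.N then c.node ⟨i, h⟩ else U2Node.const false

def evalAux (c : U2Circuit n m) (x : Fin n → Bool) (y : Fin m → Bool) : ℕ → Bool
  | i =>
    match c.nodeAt i with
    | U2Node.actual a => x a
    | U2Node.guess g => y g
    | U2Node.const b => b
    | U2Node.gate a b cc j k =>
        xor
          ((xor (if _h : j < i then c.evalAux x y j else false) a) &&
           (xor (if _h : k < i then c.evalAux x y k else false) b))
          cc
termination_by i => i

def eval (c : U2Circuit n m) (x : Fin n → Bool) (y : Fin m → Bool) : Bool :=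
  c.evalAux x y c.output

/-- A nondeterministic `U₂`-circuit computes `f` if for every actual input `x`,
`f x = 1` iff some assignment of the guess inputs makes the circuit output 1. -/
def Computes (c : U2Circuit n m) (f : (Fin n → Bool) → Bool) : Prop :=
  ∀ x : Fin n → Bool, f x = true ↔ ∃ y : Fin m → Bool, c.eval x y = true

/-- The size of a `U₂`-circuit: the number of its gates. -/
def size (c : U2Circuit n m) : ℕ :=
  (Finset.univ.filter (fun i : Fin c.N => (c.node i).isGate = true)).card

end U2Circuit

/-- `size^dc f`: the size of the smallest deterministic `U₂`-circuit
computing `f`. -/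
noncomputable def sizeDC {n : ℕ} (f : (Fin n → Bool) → Bool) : ℕ :=
  sInf {s : ℕ | ∃ c : U2Circuit n 0, c.Computes f ∧ c.size = s}

/-- `size^ndc f`: the size of the smallest nondeterministic `U₂`-circuit
computing `f`. -/
noncomputable def sizeNDC {n : ℕ} (f : (Fin n → Bool) → Bool) : ℕ :=
  sInf {s : ℕ | ∃ m : ℕ, ∃ c : U2Circuit n m, c.Computes f ∧ c.size = s}

/-- The parity function: `parityFun n x = 1` iff `Σ xᵢ ≡ 1 (mod 2)`. -/
def parityFun (n : ℕ) : (Fin n → Bool) → Bool :=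
  fun x => decide ((∑ i : Fin n, (x i).toNat) % 2 = 1)

theorem blockIdx_lt {m : ℕ} (i j : Fin m) : m * (i : ℕ) + (j : ℕ) < m * m := by
  have hi := i.isLt
  have hj := j.isLt
  nlinarith

/-- The disjunction of the parities of the `m` consecutive blocks of `m`
variables:
`⋁_{i=0}^{m-1} Parity_m (x_{m·i+1}, …, x_{m·i+m})` on `n = m²` variables. -/
def blockParityOr (m : ℕ) : (Fin (m * m) → Bool) → Bool :=
  fun x => decide (∃ i : Fin m,
    parityFun m (fun j => x ⟨m * (i : ℕ) + (j : ℕ), blockIdx_lt i j⟩) = true)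

/-- The right-hand side of an assignment in a straight-line register program over
the registers `R`, reading the inputs `x : Fin n → Bool`. -/
inductive RegOp (R : Type) (n : ℕ) : Type where
  | input : Fin n → RegOp R n
  | const : Bool → RegOp R n
  | and : R → R → RegOp R n
  | or : R → R → RegOp R n
  | not : R → RegOp R n
  | copy : R → RegOp R n

namespace RegOp

variable {R : Type} {n : ℕ}

/-- The value of a right-hand side in the register state `ρ`. -/
def eval (x : Fin n → Bool) (ρ : R → Bool) : RegOp R n → Bool
  | input a => x a
  | const b => b
  | and a b => ρ a && ρ b
  | or a b => ρ a || ρ b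
  | not a => !ρ a
  | copy a => ρ a

/-- The circuit node for a right-hand side, where `pos` locates the registers. -/
def toNode (pos : R → ℕ) : RegOp R n → CNode n 0
  | input a => CNode.actual a
  | const b => CNode.const b
  | and a b => CNode.gand (pos a) (pos b)
  | or a b => CNode.gor (pos a) (pos b)
  | not a => CNode.gnot (pos a)
  | copy a => CNode.gcopy (pos a)

theorem exists_pos_of_mem_preds_toNode {pos : R → ℕ} {o : RegOp R n} {j : ℕ}
    (h : j ∈ (o.toNode pos).preds) : ∃ a, j = pos a := by
  cases o <;> simp [toNode, CNode.preds] at h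
  · rcases h with h | h <;> exact ⟨_, h⟩
  · rcases h with h | h <;> exact ⟨_, h⟩
  · exact ⟨_, h⟩
  · exact ⟨_, h⟩

end RegOp

/-- A straight-line register program: a list of assignments. -/
abbrev RegProg (R : Type) (n : ℕ) : Type := List (R × RegOp R n)

namespace RegProg

variable {R : Type} {n : ℕ}

open Classical in
/-- The register state after running the program from the state `ρ`. -/
noncomputable def run (x : Fin n → Bool) (P : RegProg R n) (ρ : R → Bool) : R → Bool :=
  P.foldl (fun σ s => Function.update σ s.1 (s.2.eval x σ)) ρ

theorem run_append (x : Fin n → Bool) (P Q : RegProg R n) (ρ : R → Bool) :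
    run x (P ++ Q) ρ = run x Q (run x P ρ) := by
  simp [run]

theorem run_singleton_self (x : Fin n → Bool) (r : R) (o : RegOp R n) (ρ : R → Bool) :
    run x [(r, o)] ρ r = o.eval x ρ := by
  simp [run]

theorem run_singleton_of_ne (x : Fin n → Bool) {r s : R} (h : s ≠ r) (o : RegOp R n)
    (ρ : R → Bool) : run x [(r, o)] ρ s = ρ s := by
  simp [run, h]

end RegProg

namespace Circuit

variable {n : ℕ}

theorem lt_of_mem_preds_nodeAt {m : ℕ} (c : Circuit n m) {i j : ℕ}
    (h : j ∈ (c.nodeAt i).preds) : j < i := by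
  unfold nodeAt at h
  split at h
  · exact c.wf _ j h
  · simp [CNode.preds] at h

theorem lt_N_of_isGate {m : ℕ} (c : Circuit n m) {i : ℕ}
    (h : (c.nodeAt i).isGate = true) : i < c.N := by
  unfold nodeAt at h
  split at h
  · assumption
  · simp [CNode.isGate] at h

section Eval

variable {m : ℕ} (c : Circuit n m) (x : Fin n → Bool) (y : Fin m → Bool) {i j k : ℕ}

theorem evalAux_actual {a : Fin n} (h : c.nodeAt i = CNode.actual a) :
    c.evalAux x y i = x a := by
  rw [evalAux, h]

theorem evalAux_const {b : Bool} (h : c.nodeAt i = CNode.const b) :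
    c.evalAux x y i = b := by
  rw [evalAux, h]

theorem evalAux_gand (h : c.nodeAt i = CNode.gand j k) :
    c.evalAux x y i = (c.evalAux x y j && c.evalAux x y k) := by
  have hj : j < i := c.lt_of_mem_preds_nodeAt (by simp [h, CNode.preds])
  have hk : k < i := c.lt_of_mem_preds_nodeAt (by simp [h, CNode.preds])
  rw [evalAux, h]; simp [hj, hk]

theorem evalAux_gor (h : c.nodeAt i = CNode.gor j k) :
    c.evalAux x y i = (c.evalAux x y j || c.evalAux x y k) := by
  have hj : j < i := c.lt_of_mem_preds_nodeAt (by simp [h, CNode.preds])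
  have hk : k < i := c.lt_of_mem_preds_nodeAt (by simp [h, CNode.preds])
  rw [evalAux, h]; simp [hj, hk]

theorem evalAux_gnot (h : c.nodeAt i = CNode.gnot j) :
    c.evalAux x y i = !c.evalAux x y j := by
  have hj : j < i := c.lt_of_mem_preds_nodeAt (by simp [h, CNode.preds])
  rw [evalAux, h]; simp [hj]

theorem evalAux_gcopy (h : c.nodeAt i = CNode.gcopy j) :
    c.evalAux x y i = c.evalAux x y j := by
  have hj : j < i := c.lt_of_mem_preds_nodeAt (by simp [h, CNode.preds])
  rw [evalAux, h]; simp [hj]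

theorem depthAux_lt_of_isGate (hg : (c.nodeAt i).isGate = true)
    (hj : j ∈ (c.nodeAt i).preds) : c.depthAux j < c.depthAux i := by
  have hji := c.lt_of_mem_preds_nodeAt hj
  rw [depthAux.eq_def c i]
  dsimp only
  cases h : c.nodeAt i with
  | gand a b =>
    simp only [h, CNode.preds, List.mem_cons, List.not_mem_nil, or_false] at hj
    rcases hj with rfl | rfl <;> simp [hji]
  | gor a b =>
    simp only [h, CNode.preds, List.mem_cons, List.not_mem_nil, or_false] at hj
    rcases hj with rfl | rfl <;> simp [hji]
  | gnot a =>
    simp only [h, CNode.preds, List.mem_cons, List.not_mem_nil, or_false] at hj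
    subst hj; simp [hji]
  | _ => simp [h, CNode.isGate] at hg

theorem depthAux_gcopy (h : c.nodeAt i = CNode.gcopy j) :
    c.depthAux i = c.depthAux j := by
  have hj : j < i := c.lt_of_mem_preds_nodeAt (by simp [h, CNode.preds])
  rw [depthAux.eq_def c i]; simp [h, hj]

theorem depthAux_le_of_mem_preds (hj : j ∈ (c.nodeAt i).preds) :
    c.depthAux j ≤ c.depthAux i := by
  cases h : c.nodeAt i with
  | gcopy a =>
    simp only [h, CNode.preds, List.mem_cons, List.not_mem_nil, or_false] at hj
    subst hj; exact (c.depthAux_gcopy h).ge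
  | gand a b => exact (c.depthAux_lt_of_isGate (by simp [h, CNode.isGate]) hj).le
  | gor a b => exact (c.depthAux_lt_of_isGate (by simp [h, CNode.isGate]) hj).le
  | gnot a => exact (c.depthAux_lt_of_isGate (by simp [h, CNode.isGate]) hj).le
  | _ => simp [h, CNode.preds] at hj

end Eval

/-- The layered node sequence of a register program over `w` registers: node
`w * t + r` holds register `r` after `t` assignments. -/
noncomputable def progNode {R : Type} {w : ℕ} (e : R ≃ Fin w) (P : RegProg R n) (i : ℕ) :
    CNode n 0 :=
  if h : w ≤ i ∧ i / w - 1 < P.length then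
    if ((e P[i / w - 1].1 : Fin w) : ℕ) = i % w then
      P[i / w - 1].2.toNode (fun a => w * (i / w - 1) + e a)
    else CNode.gcopy (i - w)
  else CNode.const false

theorem exists_of_mem_preds_progNode {R : Type} {w : ℕ} (e : R ≃ Fin w) (P : RegProg R n)
    {i j : ℕ} (h : j ∈ (progNode e P i).preds) : w ≤ i ∧ j / w + 1 = i / w ∧ j < i := by
  unfold progNode at h
  split at h
  case isFalse => simp [CNode.preds] at h
  case isTrue hi =>
    have hw : 0 < w := by
      rcases Nat.eq_zero_or_pos w with rfl | hw
      · exact (e (P[i / 0 - 1]'hi.2).1).elim0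
      · exact hw
    have h1 : 1 ≤ i / w := (Nat.one_le_div_iff hw).2 hi.1
    have key : j / w + 1 = i / w := by
      split at h
      · obtain ⟨a, rfl⟩ := RegOp.exists_pos_of_mem_preds_toNode h
        rw [Nat.mul_add_div hw, Nat.div_eq_of_lt (e a).isLt]
        omega
      · simp only [CNode.preds, List.mem_cons, List.not_mem_nil, or_false] at h
        subst h
        have := Nat.sub_mul_div i w 1
        rw [mul_one] at this
        omega
    refine ⟨hi.1, key, ?_⟩
    by_contra hc
    have := Nat.div_le_div_right (c := w) (not_lt.1 hc)
    omega

/-- The layered circuit simulating a register program, with output register `out`. -/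
noncomputable def ofProg {R : Type} {w : ℕ} (e : R ≃ Fin w) (P : RegProg R n) (out : R) :
    Circuit n 0 where
  N := w * P.length + w
  node i := progNode e P i
  output := ⟨w * P.length + e out, by have := (e out).isLt; omega⟩
  wf i j h := (exists_of_mem_preds_progNode e P h).2.2
  guessOnce g := g.elim0

theorem ofProg_evalAux {R : Type} {w : ℕ} (e : R ≃ Fin w) (P : RegProg R n) (out : R)
    (x : Fin n → Bool) (y : Fin 0 → Bool) (t : ℕ) (ht : t ≤ P.length) (r : R) :
    (ofProg e P out).evalAux x y (w * t + e r) =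
      RegProg.run x (P.take t) (fun _ => false) r := by
  have hw : 0 < w := (e r).pos
  induction t generalizing r with
  | zero =>
    have : (ofProg e P out).nodeAt (w * 0 + e r) = CNode.const false := by
      have := (e r).isLt
      simp [nodeAt, ofProg, progNode]
    rw [evalAux_const _ _ _ this]; simp [RegProg.run]
  | succ t ih =>
    have ht' : t < P.length := ht
    have hdiv : (w * (t + 1) + e r) / w - 1 = t := by
      rw [Nat.mul_add_div hw, Nat.div_eq_of_lt (e r).isLt]; omega
    have hmod : (w * (t + 1) + e r) % w = e r := by
      rw [Nat.mul_add_mod, Nat.mod_eq_of_lt (e r).isLt]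
    have hN : w * (t + 1) + e r < (ofProg e P out).N := by
      have h1 := (e r).isLt
      have h2 : w * (t + 1) ≤ w * P.length := Nat.mul_le_mul_left _ ht
      show _ < w * P.length + w
      omega
    have hwi : w ≤ w * (t + 1) + e r := by rw [mul_add]; omega
    have hnode : (ofProg e P out).nodeAt (w * (t + 1) + e r) =
        if e P[t].1 = e r then P[t].2.toNode (fun a => w * t + e a)
        else CNode.gcopy (w * t + e r) := by
      have hsub : w * (t + 1) + e r - w = w * t + e r := by rw [mul_add]; omega
      rw [nodeAt, dif_pos hN]
      show progNode e P _ = _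
      unfold progNode
      simp only [hdiv, hmod, hwi, ht', hsub, Fin.ext_iff, and_self, dif_pos]
    have htake : P.take (t + 1) = P.take t ++ [(P[t].1, P[t].2)] := by
      rw [List.take_succ_eq_append_getElem ht']
    rw [htake, RegProg.run_append]
    by_cases hr : P[t].1 = r
    · rw [if_pos (by rw [hr])] at hnode
      subst hr
      rw [RegProg.run_singleton_self]
      have ih' := ih ht'.le
      cases ho : P[t].2 with
      | input a => rw [ho] at hnode; rw [evalAux_actual _ _ _ hnode]; rfl
      | const a => rw [ho] at hnode; rw [evalAux_const _ _ _ hnode]; rfl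
      | and a b => rw [ho] at hnode; rw [evalAux_gand _ _ _ hnode, ih', ih']; rfl
      | or a b => rw [ho] at hnode; rw [evalAux_gor _ _ _ hnode, ih', ih']; rfl
      | not a => rw [ho] at hnode; rw [evalAux_gnot _ _ _ hnode, ih']; rfl
      | copy a => rw [ho] at hnode; rw [evalAux_gcopy _ _ _ hnode, ih']; rfl
    · rw [if_neg (fun h => hr (e.injective h))] at hnode
      rw [RegProg.run_singleton_of_ne _ (Ne.symm hr), evalAux_gcopy _ _ _ hnode, ih ht'.le]

theorem ofProg_eval {R : Type} {w : ℕ} (e : R ≃ Fin w) (P : RegProg R n) (out : R)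
    (x : Fin n → Bool) (y : Fin 0 → Bool) :
    (ofProg e P out).eval x y = RegProg.run x P (fun _ => false) out := by
  have := ofProg_evalAux e P out x y P.length le_rfl out
  rwa [List.take_length] at this

theorem ofProg_hasWidth {R : Type} {w : ℕ} (e : R ≃ Fin w) (P : RegProg R n) (out : R) :
    (ofProg e P out).HasWidth w := by
  refine ⟨fun i => i / w, fun i j hj _ => (exists_of_mem_preds_progNode e P hj).2.1,
    fun t => ?_⟩
  have hw : 0 < w := (e out).pos
  refine (Finset.card_le_card_of_injOn (t := Finset.range w) (fun i : Fin (ofProg e P out).N => (i : ℕ) % w)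
    (fun i _ => by simpa using Nat.mod_lt _ hw) ?_).trans_eq (Finset.card_range w)
  intro i hi j hj hij
  simp only [Finset.coe_filter, Set.mem_ofPred_eq] at hi hj hij
  have h1 := Nat.div_add_mod (i : ℕ) w
  have h2 := Nat.div_add_mod (j : ℕ) w
  rw [hi.2.1, hij] at h1
  rw [hj.2.1] at h2
  exact Fin.ext (h1.symm.trans h2)

theorem ofProg_size_le {R : Type} {w : ℕ} (e : R ≃ Fin w) (P : RegProg R n) (out : R) :
    (ofProg e P out).size ≤ P.length := by
  have key : ∀ i : ℕ, (progNode e P i).isGate = true →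
      ∃ h : i / w - 1 < P.length, i = w * (i / w - 1) + w + e (P[i / w - 1]'h).1 := by
    intro i hi
    unfold progNode at hi
    split at hi
    case isFalse => simp [CNode.isGate] at hi
    case isTrue h =>
      refine ⟨h.2, ?_⟩
      have hw : 0 < w := (e P[i / w - 1].1).pos
      have h1 : 1 ≤ i / w := (Nat.one_le_div_iff hw).2 h.1
      split at hi
      case isFalse => simp [CNode.isGate] at hi
      case isTrue h' =>
        rw [h']
        have h2 := Nat.div_add_mod i w
        obtain ⟨q, hq⟩ := Nat.exists_eq_add_of_le h1
        rw [hq, mul_add] at h2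
        rw [hq, Nat.add_sub_cancel_left]
        omega
  unfold size
  rw [← Finset.card_range P.length]
  refine Finset.card_le_card_of_injOn (fun i => (i : ℕ) / w - 1) ?_ ?_
  · intro i hi
    simp only [Finset.coe_filter, Set.mem_ofPred_eq] at hi
    obtain ⟨h, -⟩ := key i hi.2
    simpa using h
  · intro i hi j hj hij
    simp only [Finset.coe_filter, Set.mem_ofPred_eq] at hi hj hij
    obtain ⟨h1, h2⟩ := key i hi.2
    obtain ⟨h3, h4⟩ := key j hj.2
    apply Fin.ext
    rw [h2, h4]
    simp only [hij]

section Evaluation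

variable (c : Circuit n 0) (A : Finset ℕ) (t : ℕ)

/-- In the state `ρ`, with one register for each stored node in `A` and `t` temporary
ones, all stored nodes up to `v` hold their values. -/
def Stored (x : Fin n → Bool) (v : ℕ) (ρ : A ⊕ Fin t → Bool) : Prop :=
  ∀ a : A, (a : ℕ) ≤ v → ρ (Sum.inl a) = c.evalAux x Fin.elim0 a

/-- Two states agree on the stored nodes and on the temporary registers below `r`. -/
def AgreeBelow (r : ℕ) (ρ σ : A ⊕ Fin t → Bool) : Prop :=
  (∀ a : A, σ (Sum.inl a) = ρ (Sum.inl a)) ∧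
    ∀ s : Fin t, (s : ℕ) < r → σ (Sum.inr s) = ρ (Sum.inr s)

/-- Node `v` can be evaluated into the temporary register `r` by fewer than
`2 ^ (b + 1)` assignments which only touch temporary registers from `r` on. -/
def EvaluatesInto (v b : ℕ) (r : Fin t) : Prop :=
  ∃ P : RegProg (A ⊕ Fin t) n, P.length + 1 ≤ 2 ^ (b + 1) ∧
    ∀ x ρ, c.Stored A t x v ρ →
      RegProg.run x P ρ (Sum.inr r) = c.evalAux x Fin.elim0 v ∧
        AgreeBelow A t r ρ (RegProg.run x P ρ)

variable {c A t}

theorem Stored.mono {x : Fin n → Bool} {v u : ℕ} {ρ : A ⊕ Fin t → Bool}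
    (h : c.Stored A t x v ρ) (hu : u ≤ v) : c.Stored A t x u ρ :=
  fun a ha => h a (ha.trans hu)

theorem Stored.of_agreeBelow {x : Fin n → Bool} {v r : ℕ} {ρ σ : A ⊕ Fin t → Bool}
    (h : c.Stored A t x v ρ) (h' : AgreeBelow A t r ρ σ) : c.Stored A t x v σ :=
  fun a ha => (h'.1 a).trans (h a ha)

theorem AgreeBelow.trans {r s : ℕ} {ρ σ τ : A ⊕ Fin t → Bool}
    (h : AgreeBelow A t r ρ σ) (h' : AgreeBelow A t s σ τ) (hrs : r ≤ s) :
    AgreeBelow A t r ρ τ :=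
  ⟨fun a => (h'.1 a).trans (h.1 a),
    fun q hq => (h'.2 q (hq.trans_le hrs)).trans (h.2 q hq)⟩

theorem EvaluatesInto.mono {v b b' : ℕ} {r : Fin t} (h : c.EvaluatesInto A t v b r)
    (hb : b ≤ b') : c.EvaluatesInto A t v b' r := by
  obtain ⟨P, hP, H⟩ := h
  exact ⟨P, hP.trans (Nat.pow_le_pow_right two_pos (by omega)), H⟩

theorem agreeBelow_run_singleton (x : Fin n → Bool) (r : Fin t)
    (o : RegOp (A ⊕ Fin t) n) (ρ : A ⊕ Fin t → Bool) :
    AgreeBelow A t r ρ (RegProg.run x [(Sum.inr r, o)] ρ) :=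
  ⟨fun a => RegProg.run_singleton_of_ne x (by simp) o ρ,
    fun s hs => RegProg.run_singleton_of_ne x
      (by simpa using fun h : s = r => absurd hs (by simp [h])) o ρ⟩

theorem evaluatesInto_of_op {v : ℕ} (b : ℕ) (r : Fin t) (o : RegOp (A ⊕ Fin t) n)
    (h : ∀ x ρ, c.Stored A t x v ρ → o.eval x ρ = c.evalAux x Fin.elim0 v) :
    c.EvaluatesInto A t v b r := by
  refine ⟨[(Sum.inr r, o)], ?_, fun x ρ hρ => ⟨?_, agreeBelow_run_singleton x r o ρ⟩⟩
  · have : 1 ≤ 2 ^ b := Nat.one_le_two_pow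
    simp [pow_succ]; omega
  · rw [RegProg.run_singleton_self, h x ρ hρ]

theorem exists_op_of_isGate {v b r : ℕ} (hg : (c.nodeAt v).isGate = true)
    (hr : r + 1 < t)
    (hev : ∀ j ∈ (c.nodeAt v).preds, ∀ s : Fin t, (s : ℕ) ≤ r + 1 →
      c.EvaluatesInto A t j b s) :
    ∃ (P : RegProg (A ⊕ Fin t) n) (o : RegOp (A ⊕ Fin t) n),
      P.length + 2 ≤ 2 ^ (b + 2) ∧
      ∀ x ρ, (∀ j < v, c.Stored A t x j ρ) →
        o.eval x (RegProg.run x P ρ) = c.evalAux x Fin.elim0 v ∧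
          AgreeBelow A t r ρ (RegProg.run x P ρ) := by
  have hpow : 2 ^ (b + 2) = 2 * 2 ^ (b + 1) := by ring
  have hpow' : 1 ≤ 2 ^ b := Nat.one_le_two_pow
  have hpow'' : 2 ^ (b + 1) = 2 * 2 ^ b := by ring
  let s₀ : Fin t := ⟨r, by omega⟩
  let s₁ : Fin t := ⟨r + 1, hr⟩
  have binary : ∀ j ∈ (c.nodeAt v).preds, ∀ k ∈ (c.nodeAt v).preds,
      ∃ P : RegProg (A ⊕ Fin t) n, P.length + 2 ≤ 2 ^ (b + 2) ∧
      ∀ x ρ, (∀ j < v, c.Stored A t x j ρ) →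
        RegProg.run x P ρ (Sum.inr s₀) = c.evalAux x Fin.elim0 j ∧
        RegProg.run x P ρ (Sum.inr s₁) = c.evalAux x Fin.elim0 k ∧
          AgreeBelow A t r ρ (RegProg.run x P ρ) := by
    intro j hj k hk
    obtain ⟨P, hP, HP⟩ := hev j hj s₀ (Nat.le_succ r)
    obtain ⟨Q, hQ, HQ⟩ := hev k hk s₁ le_rfl
    refine ⟨P ++ Q, by rw [List.length_append]; omega, fun x ρ hρ => ?_⟩
    obtain ⟨h1, h2⟩ := HP x ρ (hρ j (c.lt_of_mem_preds_nodeAt hj))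
    obtain ⟨h3, h4⟩ := HQ x (RegProg.run x P ρ)
      ((hρ k (c.lt_of_mem_preds_nodeAt hk)).of_agreeBelow h2)
    rw [RegProg.run_append]
    exact ⟨(h4.2 s₀ (Nat.lt_succ_self r)).trans h1, h3, h2.trans h4 (Nat.le_succ r)⟩
  cases h : c.nodeAt v with
  | gand j k =>
    obtain ⟨P, hP, HP⟩ := binary j (by simp [h, CNode.preds]) k (by simp [h, CNode.preds])
    refine ⟨P, .and (Sum.inr s₀) (Sum.inr s₁), hP, fun x ρ hρ => ?_⟩
    obtain ⟨h1, h2, h3⟩ := HP x ρ hρ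
    exact ⟨by rw [c.evalAux_gand _ _ h, RegOp.eval, h1, h2], h3⟩
  | gor j k =>
    obtain ⟨P, hP, HP⟩ := binary j (by simp [h, CNode.preds]) k (by simp [h, CNode.preds])
    refine ⟨P, .or (Sum.inr s₀) (Sum.inr s₁), hP, fun x ρ hρ => ?_⟩
    obtain ⟨h1, h2, h3⟩ := HP x ρ hρ
    exact ⟨by rw [c.evalAux_gor _ _ h, RegOp.eval, h1, h2], h3⟩
  | gnot j =>
    have hj : j ∈ (c.nodeAt v).preds := by simp [h, CNode.preds]
    obtain ⟨P, hP, HP⟩ := hev j hj s₀ (Nat.le_succ r)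
    refine ⟨P, .not (Sum.inr s₀), by omega, fun x ρ hρ => ?_⟩
    obtain ⟨h1, h2⟩ := HP x ρ (hρ j (c.lt_of_mem_preds_nodeAt hj))
    exact ⟨by rw [c.evalAux_gnot _ _ h, RegOp.eval, h1], h2⟩
  | _ => simp [h, CNode.isGate] at hg

/-- If `lab` bounds the depth of the circuit cut at the nodes of `A`, then each node
is evaluated by a depth-first traversal of its unfolding down to inputs and stored nodes. -/
theorem evaluatesInto_label {V : ℕ → Prop} {lab : ℕ → ℕ}
    (hV : ∀ v, V v → ∀ j ∈ (c.nodeAt v).preds, V j)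
    (hlt : ∀ v, V v → v ∉ A → (c.nodeAt v).isGate = true →
      ∀ j ∈ (c.nodeAt v).preds, lab j < lab v)
    (hcopy : ∀ v j, c.nodeAt v = CNode.gcopy j → lab j ≤ lab v)
    (v : ℕ) (hv : V v) (r : Fin t) (hr : lab v + r < t) :
    c.EvaluatesInto A t v (lab v) r := by
  induction v using Nat.strong_induction_on generalizing r with
  | _ v ih =>
  by_cases hA : v ∈ A
  · exact evaluatesInto_of_op _ r (.copy (Sum.inl ⟨v, hA⟩)) fun x ρ hρ => hρ ⟨v, hA⟩ le_rfl
  by_cases hg : (c.nodeAt v).isGate = true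
  · have hpos : 0 < lab v := by
      cases h : c.nodeAt v with
      | gand j k => exact (Nat.zero_le _).trans_lt (hlt v hv hA hg j (by simp [h, CNode.preds]))
      | gor j k => exact (Nat.zero_le _).trans_lt (hlt v hv hA hg j (by simp [h, CNode.preds]))
      | gnot j => exact (Nat.zero_le _).trans_lt (hlt v hv hA hg j (by simp [h, CNode.preds]))
      | _ => simp [h, CNode.isGate] at hg
    obtain ⟨b, hb⟩ := Nat.exists_eq_succ_of_ne_zero hpos.ne'
    have hev : ∀ j ∈ (c.nodeAt v).preds, ∀ s : Fin t, (s : ℕ) ≤ r + 1 →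
        c.EvaluatesInto A t j b s := by
      intro j hj s hs
      have := hlt v hv hA hg j hj
      exact (ih j (c.lt_of_mem_preds_nodeAt hj) (hV v hv j hj) s (by omega)).mono (by omega)
    obtain ⟨P, o, hP, H⟩ := exists_op_of_isGate hg (r := r) (by omega) hev
    refine ⟨P ++ [(Sum.inr r, o)], ?_, fun x ρ hρ => ?_⟩
    · rw [hb, List.length_append, List.length_singleton]
      exact hP
    obtain ⟨h1, h2⟩ := H x ρ fun j hj => hρ.mono hj.le
    rw [RegProg.run_append, RegProg.run_singleton_self]
    exact ⟨h1, h2.trans (agreeBelow_run_singleton x r o _) le_rfl⟩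
  · cases h : c.nodeAt v with
    | actual a =>
      exact evaluatesInto_of_op _ r (.input a) fun x ρ _ => (c.evalAux_actual _ _ h).symm
    | const a =>
      exact evaluatesInto_of_op _ r (.const a) fun x ρ _ => (c.evalAux_const _ _ h).symm
    | guess g => exact g.elim0
    | gcopy j =>
      have hj : j ∈ (c.nodeAt v).preds := by simp [h, CNode.preds]
      have hjv := c.lt_of_mem_preds_nodeAt hj
      have hl := hcopy v j h
      obtain ⟨P, hP, H⟩ := (ih j hjv (hV v hv j hj) r (by omega)).mono hl
      refine ⟨P, hP, fun x ρ hρ => ?_⟩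
      rw [c.evalAux_gcopy _ _ h]
      exact H x ρ (hρ.mono hjv.le)
    | _ => simp [h, CNode.isGate] at hg

/-- A circuit that has depth at most `M` after cutting it at the gates in `A` can be
simulated by storing the values of `A` and evaluating the pieces one after the other. -/
theorem exists_bounded_width_of_cut {V : ℕ → Prop} {lab : ℕ → ℕ} {M : ℕ}
    (hV : ∀ v, V v → ∀ j ∈ (c.nodeAt v).preds, V j)
    (hout : V c.output)
    (hAV : ∀ v ∈ A, V v ∧ (c.nodeAt v).isGate = true)
    (hM : ∀ v, V v → lab v ≤ M)
    (hlt : ∀ v, V v → v ∉ A → (c.nodeAt v).isGate = true →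
      ∀ j ∈ (c.nodeAt v).preds, lab j < lab v)
    (hcopy : ∀ v j, c.nodeAt v = CNode.gcopy j → lab j ≤ lab v) :
    ∃ c' : Circuit n 0, (∀ x y, c'.eval x y = c.eval x y) ∧
      c'.size ≤ (A.card + 1) * 2 ^ (M + 2) ∧ c'.HasWidth (A.card + (M + 2)) := by
  have hev : ∀ v, V v → ∀ s : Fin (M + 2), (s : ℕ) ≤ 1 →
      c.EvaluatesInto A (M + 2) v M s := fun v hv s hs =>
    (evaluatesInto_label hV hlt hcopy v hv s (by have := hM v hv; omega)).mono (hM v hv)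
  have store : ∀ m : ℕ, ∃ P : RegProg (A ⊕ Fin (M + 2)) n,
      P.length ≤ (A.filter (· < m)).card * 2 ^ (M + 2) ∧
      ∀ x ρ, ∀ j < m, c.Stored A (M + 2) x j (RegProg.run x P ρ) := by
    intro m
    induction m with
    | zero => exact ⟨[], by simp, fun x ρ j hj => absurd hj (Nat.not_lt_zero j)⟩
    | succ m ih =>
      obtain ⟨P, hP, H⟩ := ih
      by_cases hm : m ∈ A
      · obtain ⟨Q, o, hQ, HQ⟩ := exists_op_of_isGate (A := A) (t := M + 2) (b := M) (r := 0)
          (hAV m hm).2 (by omega) fun j hj => hev j (hV m (hAV m hm).1 j hj)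
        have hcard : (A.filter (· < m + 1)).card = (A.filter (· < m)).card + 1 := by
          have : A.filter (· < m + 1) = insert m (A.filter (· < m)) := by
            ext a
            simp only [Finset.mem_filter, Finset.mem_insert, Nat.lt_succ_iff_lt_or_eq]
            constructor
            · rintro ⟨h1, h2 | h2⟩
              · exact Or.inr ⟨h1, h2⟩
              · exact Or.inl h2
            · rintro (rfl | ⟨h1, h2⟩)
              · exact ⟨hm, Or.inr rfl⟩
              · exact ⟨h1, Or.inl h2⟩
          rw [this, Finset.card_insert_of_notMem (by simp)]
        refine ⟨P ++ (Q ++ [(Sum.inl ⟨m, hm⟩, o)]), ?_, fun x ρ j hj a ha => ?_⟩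
        · rw [hcard, add_mul]
          simp only [List.length_append, List.length_singleton]
          omega
        · obtain ⟨h1, h2⟩ := HQ x (RegProg.run x P ρ) (H x ρ)
          rw [RegProg.run_append, RegProg.run_append]
          by_cases ham : (a : ℕ) = m
          · obtain rfl : a = ⟨m, hm⟩ := Subtype.ext ham
            rw [RegProg.run_singleton_self, h1]
          · rw [RegProg.run_singleton_of_ne _ (fun h => ham (congrArg Subtype.val (Sum.inl.inj h))), h2.1]
            exact H x ρ a (by omega) a le_rfl
      · refine ⟨P, hP.trans (Nat.mul_le_mul_right _ (Finset.card_le_card fun a ha => ?_)),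
          fun x ρ j hj a ha => ?_⟩
        · simp only [Finset.mem_filter] at ha ⊢
          exact ⟨ha.1, by omega⟩
        · have : (a : ℕ) ≠ m := fun h => hm (h ▸ a.2)
          exact H x ρ a (by omega) a le_rfl
  obtain ⟨P, hP, H⟩ := store (c.output + 1)
  obtain ⟨Q, hQ, HQ⟩ := hev c.output hout 0 (by simp)
  let e : A ⊕ Fin (M + 2) ≃ Fin (A.card + (M + 2)) :=
    Fintype.equivFinOfCardEq (by simp)
  refine ⟨ofProg e (P ++ Q) (Sum.inr 0), fun x y => ?_, ?_, ofProg_hasWidth _ _ _⟩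
  · rw [ofProg_eval, RegProg.run_append,
      (HQ x _ (H x _ c.output (Nat.lt_succ_self _))).1, eval, Subsingleton.elim y Fin.elim0]
  · refine (ofProg_size_le _ _ _).trans ?_
    have h1 : (A.filter (· < (c.output : ℕ) + 1)).card * 2 ^ (M + 2) ≤ A.card * 2 ^ (M + 2) :=
      Nat.mul_le_mul_right _ (Finset.card_filter_le _ _)
    have h2 : 2 ^ (M + 2) = 2 * 2 ^ (M + 1) := by ring
    rw [List.length_append, add_mul]
    omega

end Evaluation

end Circuit

/-- The highest base-`B` digit in which `u` and `v` differ is the digit `b`. -/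
def TopDigitDiff (B b u v : ℕ) : Prop :=
  u / B ^ (b + 1) = v / B ^ (b + 1) ∧ u / B ^ b ≠ v / B ^ b

/-- The number obtained from `q` by deleting its base-`B` digit `b`. -/
def deleteDigit (B b q : ℕ) : ℕ := q / B ^ (b + 1) * B ^ b + q % B ^ b

theorem TopDigitDiff.unique {B b b' u v : ℕ} (h : TopDigitDiff B b u v)
    (h' : TopDigitDiff B b' u v) : b = b' := by
  have key : ∀ {b b'}, TopDigitDiff B b u v → TopDigitDiff B b' u v → ¬ b < b' := by
    intro b b' h h' hlt
    obtain ⟨k, rfl⟩ := Nat.exists_eq_add_of_le (Nat.succ_le_of_lt hlt)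
    apply h'.2
    rw [pow_add, ← Nat.div_div_eq_div_mul, ← Nat.div_div_eq_div_mul, Nat.succ_eq_add_one, h.1]
  exact le_antisymm (not_lt.1 (key h' h)) (not_lt.1 (key h h'))

theorem deleteDigit_lt {B b u v : ℕ} (hB : 0 < B) (huv : u < v)
    (h : ¬ TopDigitDiff B b u v) : deleteDigit B b u < deleteDigit B b v := by
  have hp : 0 < B ^ b := pow_pos hB b
  unfold deleteDigit
  rcases (Nat.div_le_div_right (c := B ^ (b + 1)) huv.le).lt_or_eq with h1 | h1
  · have h2 := Nat.mod_lt u hp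
    have h3 : (u / B ^ (b + 1) + 1) * B ^ b ≤ v / B ^ (b + 1) * B ^ b :=
      Nat.mul_le_mul_right _ h1
    rw [add_mul, one_mul] at h3
    exact (Nat.add_lt_add_left h2 _).trans_le (h3.trans (Nat.le_add_right _ _))
  · have h2 : u / B ^ b = v / B ^ b := by
      by_contra h2; exact h ⟨h1, h2⟩
    have h3 := Nat.div_add_mod u (B ^ b)
    have h4 := Nat.div_add_mod v (B ^ b)
    rw [h2] at h3
    rw [h1]
    omega

theorem deleteDigit_le {B b q X : ℕ} (hB : 0 < B) (hq : q ≤ X) (hX : B ^ (b + 1) ≤ X) :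
    deleteDigit B b q ≤ 2 * (X / B) := by
  have h1 : B ^ b ≤ X / B := by
    rwa [Nat.le_div_iff_mul_le hB, ← pow_succ]
  have h2 : q / B ^ (b + 1) * B ^ b ≤ X / B := by
    rw [Nat.le_div_iff_mul_le hB, mul_assoc, ← pow_succ]
    exact (Nat.div_mul_le_self _ _).trans hq
  have h3 := Nat.mod_lt q (pow_pos hB b)
  unfold deleteDigit
  omega

namespace Circuit

variable {n : ℕ}

open Classical in
/-- The gates having an incoming wire along which the depths first differ in digit `b`. -/
noncomputable def digitGates (c : Circuit n 0) (B b : ℕ) : Finset ℕ :=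
  (Finset.range c.N).filter fun v => (c.nodeAt v).isGate = true ∧
    ∃ j ∈ (c.nodeAt v).preds, TopDigitDiff B b (c.depthAux j) (c.depthAux v)

theorem card_filter_isGate_le_size (c : Circuit n 0) :
    ((Finset.range c.N).filter fun v => (c.nodeAt v).isGate = true).card ≤ c.size := by
  unfold size
  refine le_trans (Finset.card_le_card ?_)
    (Finset.card_image_le (f := fun i : Fin c.N => (i : ℕ)))
  intro v hv
  simp only [Finset.mem_filter, Finset.mem_range] at hv
  simp only [Finset.mem_image, Finset.mem_filter, Finset.mem_univ, true_and]
  refine ⟨⟨v, hv.1⟩, ?_, rfl⟩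
  simpa [nodeAt, hv.1] using hv.2

theorem sum_card_digitGates_le (c : Circuit n 0) (B K : ℕ) :
    ∑ b ∈ Finset.range K, (c.digitGates B b).card ≤ 2 * c.size := by
  classical
  set G := (Finset.range c.N).filter fun v => (c.nodeAt v).isGate = true with hG
  have hsub : ∀ b, c.digitGates B b = G.filter fun v =>
      ∃ j ∈ (c.nodeAt v).preds, TopDigitDiff B b (c.depthAux j) (c.depthAux v) := by
    intro b
    rw [hG, Finset.filter_filter]
    unfold digitGates
    congr
  have hv : ∀ v, ((Finset.range K).filter fun b => ∃ j ∈ (c.nodeAt v).preds,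
      TopDigitDiff B b (c.depthAux j) (c.depthAux v)).card ≤ 2 := by
    intro v
    have hlen : (c.nodeAt v).preds.toFinset.card ≤ 2 := by
      refine (List.toFinset_card_le _).trans ?_
      cases c.nodeAt v <;> simp [CNode.preds]
    refine le_trans ?_ ((Finset.card_biUnion_le_card_mul (c.nodeAt v).preds.toFinset
      (fun j => (Finset.range K).filter fun b =>
        TopDigitDiff B b (c.depthAux j) (c.depthAux v)) 1 ?_).trans (by omega))
    · refine Finset.card_le_card fun b hb => ?_
      simp only [Finset.mem_filter, Finset.mem_biUnion, List.mem_toFinset] at hb ⊢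
      obtain ⟨hb, j, hj, h⟩ := hb
      exact ⟨j, hj, hb, h⟩
    · intro j _
      refine Finset.card_le_one.2 fun a ha b hb => ?_
      simp only [Finset.mem_filter] at ha hb
      exact ha.2.unique hb.2
  calc ∑ b ∈ Finset.range K, (c.digitGates B b).card
      = ∑ v ∈ G, ((Finset.range K).filter fun b => ∃ j ∈ (c.nodeAt v).preds,
          TopDigitDiff B b (c.depthAux j) (c.depthAux v)).card := by
        simp only [hsub, Finset.card_filter]
        exact Finset.sum_comm
    _ ≤ ∑ _v ∈ G, 2 := Finset.sum_le_sum fun v _ => hv v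
    _ = 2 * G.card := by rw [Finset.sum_const, smul_eq_mul, mul_comm]
    _ ≤ 2 * c.size := Nat.mul_le_mul_left _ c.card_filter_isGate_le_size

/-- Valiant's depth reduction, followed by storing the cut gates. -/
theorem exists_bounded_width (c : Circuit n 0) {B K X : ℕ} (hB : 0 < B) (hK : 0 < K)
    (hBK : B ^ K ≤ X) (hd : c.depth ≤ X) :
    ∃ (c' : Circuit n 0) (a : ℕ), (∀ x y, c'.eval x y = c.eval x y) ∧
      K * a ≤ 2 * c.size ∧ c'.size ≤ (a + 1) * 2 ^ (2 * (X / B) + 2) ∧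
      c'.HasWidth (a + (2 * (X / B) + 2)) := by
  classical
  obtain ⟨b, hb, hcard⟩ : ∃ b ∈ Finset.range K, K * (c.digitGates B b).card ≤ 2 * c.size := by
    refine Finset.exists_le_of_sum_le ⟨0, Finset.mem_range.2 hK⟩ ?_
    rw [← Finset.mul_sum, Finset.sum_const, Finset.card_range, smul_eq_mul]
    exact Nat.mul_le_mul_left _ (c.sum_card_digitGates_le B K)
  have hbX : B ^ (b + 1) ≤ X :=
    (Nat.pow_le_pow_right hB (Finset.mem_range.1 hb)).trans hBK
  set A := (c.digitGates B b).filter fun v => c.depthAux v ≤ X with hA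
  have hmem : ∀ v, v ∈ A ↔ ((v < c.N ∧ (c.nodeAt v).isGate = true ∧
      ∃ j ∈ (c.nodeAt v).preds, TopDigitDiff B b (c.depthAux j) (c.depthAux v)) ∧
      c.depthAux v ≤ X) := by
    intro v
    simp only [hA, digitGates, Finset.mem_filter, Finset.mem_range]
  obtain ⟨c', h1, h2, h3⟩ := exists_bounded_width_of_cut (c := c) (A := A)
    (V := fun v => c.depthAux v ≤ X) (lab := fun v => deleteDigit B b (c.depthAux v))
    (M := 2 * (X / B))
    (fun v hv j hj => (c.depthAux_le_of_mem_preds hj).trans hv) hd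
    (fun v hv => ⟨((hmem v).1 hv).2, ((hmem v).1 hv).1.2.1⟩)
    (fun v hv => deleteDigit_le hB hv hbX)
    (fun v hv hvA hg j hj => deleteDigit_lt hB (c.depthAux_lt_of_isGate hg hj) fun h =>
      hvA ((hmem v).2 ⟨⟨c.lt_N_of_isGate hg, hg, j, hj, h⟩, hv⟩))
    (fun v j h => by simp only [c.depthAux_gcopy h, le_refl])
  exact ⟨c', A.card, h1,
    (Nat.mul_le_mul_left _ (Finset.card_filter_le _ _)).trans hcard, h2, h3⟩

end Circuit

/-- For every `ε > 0` and all constants `C, D > 0` there are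
`c > 0` and a threshold `n₀` such that for all `n ≥ n₀`: every deterministic
circuit with `n` inputs of size at most `C·n` and depth at most `D·log₂ n` can
be converted to a deterministic circuit computing the same Boolean function, of
size at most `c·n^(1+ε)` and width at most `c·n / log₂ log₂ n`. -/
theorem linear_size_log_depth_to_bounded_width :
    ∀ ε C D : ℝ, 0 < ε → 0 < C → 0 < D →
      ∃ c : ℝ, 0 < c ∧ ∃ n₀ : ℕ,
        ∀ n : ℕ, n₀ ≤ n →
          ∀ (circ : Circuit n 0) (f : (Fin n → Bool) → Bool),
            circ.Computes f → (circ.size : ℝ) ≤ C * (n : ℝ) →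
            (circ.depth : ℝ) ≤ D * Real.logb 2 (n : ℝ) →
            ∃ circ' : Circuit n 0, circ'.Computes f ∧
              (circ'.size : ℝ) ≤ c * (n : ℝ) ^ ((1 : ℝ) + ε) ∧
              ∃ w : ℕ, circ'.HasWidth w ∧
                (w : ℝ) ≤ c * (n : ℝ) / Real.logb 2 (Real.logb 2 (n : ℝ)) := by
  intro ε C D hε hC hD
  obtain ⟨B, hB⟩ := exists_nat_ge (max 2 (2 * D / ε))
  have hB2 : 2 ≤ B := by exact_mod_cast (le_max_left _ _).trans hB
  have hBε : 2 * D ≤ ε * B := by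
    rw [mul_comm ε]
    exact (div_le_iff₀ hε).1 ((le_max_right _ _).trans hB)
  have hB0 : (0 : ℝ) < B := by exact_mod_cast (by omega : 0 < B)
  have hlB : 0 ≤ Real.logb 2 B :=
    Real.logb_nonneg one_lt_two (by exact_mod_cast (by omega : 1 ≤ B))
  obtain ⟨m, hm⟩ := exists_nat_ge (max 2 (B / D))
  set c₁ : ℝ := 2 * Real.logb 2 B + |Real.logb 2 D| with hc₁
  have hc₁0 : 0 ≤ c₁ := by positivity
  refine ⟨4 * (2 * C + 1) + (2 * C * c₁ + 18 * D), by positivity, 2 ^ m, ?_⟩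
  intro n hn circ f hf hsize hdepth
  have hn1 : (1 : ℝ) ≤ n := by exact_mod_cast Nat.one_le_two_pow.trans hn
  have hn0 : (0 : ℝ) < n := by linarith
  set L := Real.logb 2 (n : ℝ) with hL
  have hmL : (m : ℝ) ≤ L := by
    rw [hL, Real.le_logb_iff_rpow_le one_lt_two hn0, Real.rpow_natCast]
    exact_mod_cast hn
  have hL2 : 2 ≤ L := ((le_max_left _ _).trans hm).trans hmL
  have hL0 : 0 < L := by linarith
  have hBL : (B : ℝ) ≤ D * L := by
    have := (div_le_iff₀ hD).1 (((le_max_right _ _).trans hm).trans hmL)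
    linarith
  have hDL : 0 ≤ D * L := by positivity
  set X := ⌊D * L⌋₊ with hX
  have hXle : (X : ℝ) ≤ D * L := Nat.floor_le hDL
  have hBX : B ≤ X := Nat.le_floor hBL
  set K := Nat.log B X with hK
  have hK0 : 0 < K := Nat.log_pos (by omega) hBX
  have hK1 : (1 : ℝ) ≤ K := by exact_mod_cast hK0
  obtain ⟨c', a, heval, hKa, hs, hw⟩ := circ.exists_bounded_width (B := B) (K := K) (X := X)
    (by omega) hK0 (Nat.pow_log_le_self B (by omega)) (Nat.le_floor hdepth)
  set M := 2 * (X / B) with hM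
  have hKa' : (K : ℝ) * a ≤ 2 * C * n := by
    have : (K : ℝ) * a ≤ 2 * circ.size := by exact_mod_cast hKa
    linarith
  have hMB : (M : ℝ) * B ≤ 2 * (D * L) := by
    have : M * B ≤ 2 * X := by
      rw [hM, mul_assoc]
      exact Nat.mul_le_mul_left _ (Nat.div_mul_le_self X B)
    have : (M : ℝ) * B ≤ 2 * X := by exact_mod_cast this
    linarith
  set LL := Real.logb 2 L with hLL
  have hLL0 : 0 < LL := Real.logb_pos one_lt_two (by linarith)
  have hLLK : LL ≤ K * c₁ := by
    have h1 : D * L ≤ (B : ℝ) ^ (K + 1) := by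
      have h2 : X + 1 ≤ B ^ (K + 1) := Nat.lt_pow_succ_log_self (by omega) X
      have h3 : ((X : ℝ) + 1) ≤ (B : ℝ) ^ (K + 1) := by exact_mod_cast h2
      exact (Nat.lt_floor_add_one _).le.trans h3
    have h2 := Real.logb_le_logb_of_le one_lt_two (by positivity) h1
    rw [Real.logb_mul hD.ne' hL0.ne', Real.logb_pow] at h2
    push_cast at h2
    have h3 := neg_abs_le (Real.logb 2 D)
    have h4 := mul_le_mul_of_nonneg_right hK1 hlB
    have h5 := mul_le_mul_of_nonneg_right hK1 (abs_nonneg (Real.logb 2 D))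
    rw [hc₁]
    linarith
  have hLLL : LL ≤ L := by
    rw [hLL, Real.logb_le_iff_le_rpow one_lt_two hL0]
    have h1 := one_add_mul_self_le_rpow_one_add (s := 1) (by norm_num) (p := L) (by linarith)
    norm_num at h1
    linarith
  have hLn : L * L ≤ 9 * n := by
    have hsq := Real.sq_sqrt hn0.le
    have hs0 : 0 < √(n : ℝ) := Real.sqrt_pos.2 hn0
    have h1 : Real.log n ≤ 2 * √(n : ℝ) := by
      have := Real.log_le_sub_one_of_pos hs0
      rw [Real.log_sqrt hn0.le] at this
      linarith
    have h2 : L * Real.log 2 = Real.log n := by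
      rw [hL, Real.logb, div_mul_cancel₀ _ (Real.log_pos one_lt_two).ne']
    have h3 : L ≤ 3 * √(n : ℝ) := by
      have := Real.log_two_gt_d9
      nlinarith
    nlinarith
  have ha0 : (0 : ℝ) ≤ a := Nat.cast_nonneg a
  refine ⟨c', fun x => ?_, ?_, a + (M + 2), hw, ?_⟩
  · simp only [heval]
    exact hf x
  · have hpow : (2 : ℝ) ^ M ≤ (n : ℝ) ^ ε := by
      have hML : (M : ℝ) ≤ L * ε := by
        refine le_of_mul_le_mul_right ?_ hB0
        nlinarith
      calc (2 : ℝ) ^ M = (2 : ℝ) ^ (M : ℝ) := (Real.rpow_natCast _ _).symm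
        _ ≤ (2 : ℝ) ^ (L * ε) := Real.rpow_le_rpow_of_exponent_le one_le_two hML
        _ = (n : ℝ) ^ ε := by
          rw [Real.rpow_mul zero_le_two, Real.rpow_logb two_pos (by norm_num) hn0]
    have ha : (a : ℝ) + 1 ≤ (2 * C + 1) * n := by
      have := mul_le_mul_of_nonneg_right hK1 ha0
      linarith
    calc (c'.size : ℝ) ≤ ((a : ℝ) + 1) * 2 ^ (M + 2) := by exact_mod_cast hs
      _ = 4 * (((a : ℝ) + 1) * 2 ^ M) := by ring
      _ ≤ 4 * ((2 * C + 1) * n * (n : ℝ) ^ ε) := by gcongr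
      _ = 4 * (2 * C + 1) * (n : ℝ) ^ (1 + ε) := by
        rw [Real.rpow_add hn0, Real.rpow_one]; ring
      _ ≤ _ := by
        gcongr
        exact le_add_of_nonneg_right (by positivity)
  · rw [le_div_iff₀ hLL0]
    have h1 : (a : ℝ) * LL ≤ 2 * C * c₁ * n := by
      calc (a : ℝ) * LL ≤ a * (K * c₁) := by gcongr
        _ = K * a * c₁ := by ring
        _ ≤ 2 * C * n * c₁ := by gcongr
        _ = _ := by ring
    have h2 : (M : ℝ) + 2 ≤ 2 * (D * L) := by
      have hB2' : (2 : ℝ) ≤ B := by exact_mod_cast hB2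
      have := mul_le_mul_of_nonneg_left hB2' (Nat.cast_nonneg (α := ℝ) M)
      linarith
    have h3 : ((M : ℝ) + 2) * LL ≤ 18 * D * n := by
      calc ((M : ℝ) + 2) * LL ≤ 2 * (D * L) * L := by gcongr
        _ = 2 * D * (L * L) := by ring
        _ ≤ 2 * D * (9 * n) := by gcongr
        _ = _ := by ring
    have h4 : 0 ≤ 4 * (2 * C + 1) * (n : ℝ) := by positivity
    push_cast
    linarith
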